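/- arXiv:1903.12284 — 2 statements merged into one kernel-verified Lean document; each statement's English description precedes it below -/
import Mathlib

section
/- Let G be a group, G₀ a finite index subgroup of G, and H ≤ G. Then H is separable in G if and only if H ∩ G₀ is separable in G₀ (where a subgroup is separable if it equals the intersection of all finite index subgroups containing it). -/
/-- A subgroup `H` of `G` is *separable* if it equals the intersection of all
finite index subgroups of `G` containing it. -/
def Subgroup.IsSeparable {G : Type*} [Group G] (H : Subgroup G) : Prop :=
  H = ⨅ K ∈ {K : Subgroup G | H ≤ K ∧ K.FiniteIndex}, K

namespace Subgroup

variable {G : Type*} [Group G]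

theorem isSeparable_iff_exists_finiteIndex {H : Subgroup G} :
    H.IsSeparable ↔ ∀ g ∉ H, ∃ K : Subgroup G, H ≤ K ∧ K.FiniteIndex ∧ g ∉ K := by
  have hle : H ≤ ⨅ K ∈ {K : Subgroup G | H ≤ K ∧ K.FiniteIndex}, K :=
    le_iInf₂ fun _ hK => hK.1
  rw [IsSeparable, ← hle.ge_iff_eq, SetLike.le_def]
  refine forall_congr' fun g => ?_
  rw [← not_imp_not]
  simp [mem_iInf]

theorem IsSeparable.subgroupOf {H : Subgroup G} (hH : H.IsSeparable) (G₀ : Subgroup G) :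
    (H.subgroupOf G₀).IsSeparable := by
  rw [isSeparable_iff_exists_finiteIndex] at hH ⊢
  intro g hg
  obtain ⟨K, hHK, hK, hgK⟩ := hH g (by rwa [mem_subgroupOf] at hg)
  exact ⟨K.subgroupOf G₀, comap_mono hHK, inferInstance, by rwa [mem_subgroupOf]⟩

theorem IsSeparable.map_subtype {G₀ : Subgroup G} [G₀.FiniteIndex] {A : Subgroup G₀}
    (hA : A.IsSeparable) : (A.map G₀.subtype).IsSeparable := by
  rw [isSeparable_iff_exists_finiteIndex] at hA ⊢
  intro g hg
  by_cases hg₀ : g ∈ G₀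
  · obtain ⟨K, hAK, hK, hgK⟩ := hA ⟨g, hg₀⟩ fun h => hg ⟨_, h, rfl⟩
    refine ⟨K.map G₀.subtype, map_mono hAK, ⟨?_⟩, ?_⟩
    · rw [index_map_subtype]
      exact mul_ne_zero hK.index_ne_zero FiniteIndex.index_ne_zero
    · rintro ⟨x, hx, rfl⟩
      exact hgK hx
  · exact ⟨G₀, map_subtype_le A, inferInstance, hg₀⟩

/-- A subgroup containing a separable subgroup with finite relative index is separable. -/
theorem IsSeparable.of_isFiniteRelIndex {A H : Subgroup G} (hA : A.IsSeparable) (hAH : A ≤ H)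
    [A.IsFiniteRelIndex H] : H.IsSeparable := by
  rw [isSeparable_iff_exists_finiteIndex] at hA ⊢
  intro g hg
  have hout (q : H ⧸ A.subgroupOf H) : (q.out : G)⁻¹ * g ∉ A := fun h =>
    hg ((H.mul_mem_cancel_left (H.inv_mem q.out.2)).1 (hAH h))
  choose K hAK hK hgK using fun q => hA _ (hout q)
  have : (⨅ q, (K q).normalCore).FiniteIndex := finiteIndex_iInf fun _ => inferInstance
  have : (⨅ q, (K q).normalCore).Normal := normal_iInf_normal fun _ => inferInstance
  refine ⟨H ⊔ ⨅ q, (K q).normalCore, le_sup_left, finiteIndex_of_le le_sup_right, fun h => ?_⟩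
  obtain ⟨x, hx, n, hn, rfl⟩ := mem_sup_of_normal_right.1 h
  let q : H ⧸ A.subgroupOf H := QuotientGroup.mk ⟨x, hx⟩
  have hqx : (q.out : G)⁻¹ * x ∈ A :=
    mem_subgroupOf.1 (QuotientGroup.eq.1 (QuotientGroup.out_eq' q))
  apply hgK q
  rw [← mul_assoc]
  exact mul_mem (hAK q hqx) (normalCore_le _ (mem_iInf.1 hn q))

end Subgroup

/-- Let `G₀` be a finite index subgroup of `G` and `H ≤ G`.  Then `H` is separable in `G`
iff `H ∩ G₀` is separable in `G₀`. -/
theorem separable_iff_separable_of_finiteIndex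
    {G : Type*} [Group G] (G₀ H : Subgroup G) (hG₀ : G₀.FiniteIndex) :
    H.IsSeparable ↔ (H.subgroupOf G₀).IsSeparable := by
  refine ⟨fun h => h.subgroupOf G₀, fun h => ?_⟩
  have hsep := h.map_subtype
  rw [Subgroup.subgroupOf_map_subtype] at hsep
  have : (H ⊓ G₀).IsFiniteRelIndex H :=
    ⟨by rw [Subgroup.inf_relIndex_left]; exact (G₀.isFiniteRelIndex_of_finiteIndex (K := H)).relIndex_ne_zero⟩
  exact hsep.of_isFiniteRelIndex inf_le_left
end

section
/- Let (G, 𝒫) be a relatively hyperbolic pair with G finitely generated. Then the collection 𝒫 of peripheral subgroups is almost malnormal in G: for all g ∈ G and P, P' ∈ 𝒫, either g⁻¹Pg ∩ P' is finite, or P = P' and g ∈ P. -/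
open Pointwise

/-- **Peripheral subgroups are an almost malnormal collection**
(consequence of Proposition 2.2 of the paper).

Let `(G, Ps)` be a relatively hyperbolic pair with `G` finitely generated.  We use the
characteristic coarse-intersection property of peripheral cosets:  in a Cayley graph of
`G` (encoded here by a proper left-invariant metric `d` on `G`), for every `R ≥ 0` there
is `M(R)` such that the `R`-neighborhoods of distinct peripheral cosets intersect in a
set of diameter at most `M(R)`.

Then the collection `Ps` is almost malnormal in `G`:  for all `g ∈ G` and `P, P' ∈ Ps`,
either `g⁻¹ P g ∩ P'` is finite, or `P = P'` and `g ∈ P`. -/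
theorem peripherals_almost_malnormal
    {G : Type*} [Group G] (Ps : Set (Subgroup G))
    (d : G → G → ℝ)
    (hmetric : ∀ x y z : G, d x z ≤ d x y + d y z)
    (hsymm : ∀ x y : G, d x y = d y x)
    (hzero : ∀ x y : G, d x y = 0 ↔ x = y)
    (hinv : ∀ a x y : G, d (a * x) (a * y) = d x y)
    -- `d` is a proper word metric: balls are finite (G finitely generated):
    (hproper : ∀ (x : G) (r : ℝ), {y : G | d x y ≤ r}.Finite)
    -- coarse intersections of distinct peripheral cosets are uniformly bounded:
    (hsep : ∀ R : ℝ, 0 ≤ R → ∃ M : ℝ, ∀ (g g' : G), ∀ P ∈ Ps, ∀ P' ∈ Ps,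
      g • (P : Set G) ≠ g' • (P' : Set G) →
      ∀ x y : G, (∃ p ∈ g • (P : Set G), d x p ≤ R) →
        (∃ p ∈ g' • (P' : Set G), d x p ≤ R) →
        (∃ p ∈ g • (P : Set G), d y p ≤ R) →
        (∃ p ∈ g' • (P' : Set G), d y p ≤ R) → d x y ≤ M) :
    ∀ g : G, ∀ P ∈ Ps, ∀ P' ∈ Ps,
      {x : G | x ∈ P' ∧ g * x * g⁻¹ ∈ P}.Finite ∨ (P = P' ∧ g ∈ P) := by
  intro g P hP P' hP'
  by_cases hcoset : g⁻¹ • (P : Set G) = (1 : G) • (P' : Set G)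
  · right
    rw [one_smul] at hcoset
    have hg : g ∈ P := by
      have h : (1 : G) ∈ g⁻¹ • (P : Set G) := hcoset ▸ P'.one_mem
      simpa [Set.mem_smul_set_iff_inv_smul_mem] using h
    refine ⟨SetLike.coe_injective ?_, hg⟩
    rw [← hcoset, smul_coe_set (P.inv_mem hg)]
  · left
    obtain ⟨M, hM⟩ := hsep |d 1 g⁻¹| (abs_nonneg _)
    have near_left : ∀ x : G, g * x * g⁻¹ ∈ P →
        ∃ p ∈ g⁻¹ • (P : Set G), d x p ≤ |d 1 g⁻¹| := fun x hx => by
      refine ⟨x * g⁻¹, ?_, ?_⟩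
      · simpa [Set.mem_smul_set_iff_inv_smul_mem, mul_assoc] using hx
      · have h := hinv x 1 g⁻¹
        rw [mul_one] at h
        exact h.trans_le (le_abs_self _)
    have near_right : ∀ x ∈ P', ∃ p ∈ (1 : G) • (P' : Set G), d x p ≤ |d 1 g⁻¹| :=
      fun x hx => ⟨x, by simpa using hx, by rw [(hzero x x).2 rfl]; exact abs_nonneg _⟩
    refine (hproper 1 M).subset fun x hx => ?_
    exact hM g⁻¹ 1 P hP P' hP' hcoset 1 x (near_left 1 (by simp)) (near_right 1 P'.one_mem)
      (near_left x hx.2) (near_right x hx.1)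
end
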